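/- arXiv:0704.2017 — 3 statements merged into one kernel-verified Lean document; each statement's English description precedes it below -/
import Mathlib

section
/- For every real δ>1 and λ>0, the limit of ν(δ,β,λ) as β→1⁻ equals ν_A(δ,λ), where ν_A(δ,λ) = 2(δ²−1+δ^λ−δ^(2−λ)−2δλ·log δ)/((δ−1)²·λ·log δ) if 0<λ≤1, and ν_A(δ,λ) = 2(δ²−1−2δ·log δ)/((δ−1)²·λ·log δ) if λ≥1. -/
open Real

noncomputable section

/-- Branch (i) of the self-interference factor, valid for `0 < λ ≤ min(β, 1-β)`. -/
def nu1 (δ β l : ℝ) : ℝ :=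
  (δ * (δ ^ l - 1) * (4 * δ ^ (2 * β) + 3 * δ ^ l - 1)
      - 2 * δ ^ (β + l) * (δ ^ β + 3 * δ - 1) * l * Real.log δ)
    / (2 * (δ ^ β - 1) ^ 2 * l * δ ^ (1 + l) * Real.log δ)

/-- Branch (ii), valid for `β ≤ λ ≤ 1-β` and `β ≤ 1/2`. -/
def nu2 (δ β l : ℝ) : ℝ :=
  (δ * (4 * δ ^ l - 1) * (δ ^ (2 * β) - 1)
      - 2 * δ ^ (β + l) * (3 * δ * β - l + δ ^ β * l) * Real.log δ)
    / (2 * (δ ^ β - 1) ^ 2 * l * δ ^ (1 + l) * Real.log δ)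

/-- Branch (iii), valid for `1-β ≤ λ ≤ β` and `β ≥ 1/2`. -/
def nu3 (δ β l : ℝ) : ℝ :=
  (-4 * δ ^ (2 + 2 * β) - 4 * δ ^ (2 + l) + δ ^ (2 * (β + l)) + 4 * δ ^ (2 + 2 * β + l)
      + 3 * δ ^ (2 + 2 * l)
      - 2 * δ ^ (1 + β + l) * (β + 3 * δ * l + δ ^ β * l - 1) * Real.log δ)
    / (2 * (δ ^ β - 1) ^ 2 * l * δ ^ (2 + l) * Real.log δ)

/-- Branch (iv), valid for `max(β,1-β) ≤ λ ≤ 1`. -/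
def nu4 (δ β l : ℝ) : ℝ :=
  (-δ ^ (2 + 2 * β) - 4 * δ ^ (2 + l) + δ ^ (2 * (β + l)) + 4 * δ ^ (2 + 2 * β + l)
      - 2 * δ ^ (1 + β + l) * (β + 3 * δ * l + δ ^ β * l - 1) * Real.log δ)
    / (2 * (δ ^ β - 1) ^ 2 * l * δ ^ (2 + l) * Real.log δ)

/-- Branch (v), valid for `λ ≥ 1`. -/
def nu5 (δ β l : ℝ) : ℝ :=
  (2 * δ * (δ ^ (2 * β) - 1) - (δ ^ β + β + 3 * δ * β - 1) * δ ^ β * Real.log δ)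
    / ((δ ^ β - 1) ^ 2 * l * δ * Real.log δ)

/-- Asymptotic self-interference factor `ν(δ,β,λ)` of a PRake receiver with finger
fraction `β`, aPDP ratio `δ` and chips-per-frame to paths ratio `λ`, assembled from
the five branches (which agree on the overlaps of their regions of validity). -/
def nu (δ β l : ℝ) : ℝ :=
  if l ≤ min β (1 - β) then nu1 δ β l
  else if β ≤ 1 / 2 ∧ l ≤ 1 - β then nu2 δ β l
  else if 1 / 2 ≤ β ∧ l ≤ β then nu3 δ β l
  else if l ≤ 1 then nu4 δ β l
  else nu5 δ β l

/-- Asymptotic self-interference factor of the all-Rake receiver (`β = 1`). -/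
def nuA (δ l : ℝ) : ℝ :=
  if l ≤ 1 then
    2 * (δ ^ (2:ℝ) - 1 + δ ^ l - δ ^ (2 - l) - 2 * δ * l * Real.log δ)
      / ((δ - 1) ^ 2 * l * Real.log δ)
  else
    2 * (δ ^ (2:ℝ) - 1 - 2 * δ * Real.log δ) / ((δ - 1) ^ 2 * l * Real.log δ)

end

open Filter

/-- Extract the limit at `1⁻` of `ν` from a branch continuous at `β = 1` and eventually equal to it. -/
lemma tendsto_nu_of_eventually_eq {δ l : ℝ} {f : ℝ → ℝ} (hf : ContinuousAt f 1)
    (h1 : f 1 = nuA δ l) (h : ∀ β, 1 / 2 < β → 1 - l < β → β < 1 → (l < 1 → l < β) → nu δ β l = f β)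
    (hl : 0 < l) :
    Tendsto (fun β : ℝ => nu δ β l) (nhdsWithin 1 (Set.Iio (1 : ℝ))) (nhds (nuA δ l)) := by
  rw [← h1]
  refine (hf.tendsto.mono_left nhdsWithin_le_nhds).congr' ?_
  have hlt : ∀ᶠ β in nhds (1 : ℝ), l < 1 → l < β := by
    by_cases hl1 : l < 1
    · filter_upwards [lt_mem_nhds hl1] with β hβ _ using hβ
    · exact Eventually.of_forall fun _ h => absurd h hl1
  filter_upwards [nhdsWithin_le_nhds (lt_mem_nhds (by norm_num : (1 / 2 : ℝ) < 1)),
    nhdsWithin_le_nhds (lt_mem_nhds (by linarith : 1 - l < 1)),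
    nhdsWithin_le_nhds hlt, self_mem_nhdsWithin] with β hβ hβl hlβ hβ1
  exact (h β hβ hβl hβ1 hlβ).symm

lemma rpow_sub_one_ne_zero {δ : ℝ} (hδ : 1 < δ) : δ ^ (1 : ℝ) - 1 ≠ 0 := by
  rw [rpow_one]; linarith

lemma continuousAt_nu3 {δ l : ℝ} (hδ : 1 < δ) (hl : 0 < l) :
    ContinuousAt (fun β => nu3 δ β l) 1 := by
  have h0 : 0 < δ := by linarith
  have hlog := (log_pos hδ).ne'
  have := rpow_sub_one_ne_zero hδ
  unfold nu3
  fun_prop (disch := first | positivity | exact Or.inl h0.ne')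

lemma continuousAt_nu4 {δ l : ℝ} (hδ : 1 < δ) (hl : 0 < l) :
    ContinuousAt (fun β => nu4 δ β l) 1 := by
  have h0 : 0 < δ := by linarith
  have hlog := (log_pos hδ).ne'
  have := rpow_sub_one_ne_zero hδ
  unfold nu4
  fun_prop (disch := first | positivity | exact Or.inl h0.ne')

lemma continuousAt_nu5 {δ l : ℝ} (hδ : 1 < δ) (hl : 0 < l) :
    ContinuousAt (fun β => nu5 δ β l) 1 := by
  have h0 : 0 < δ := by linarith
  have hlog := (log_pos hδ).ne'
  have := rpow_sub_one_ne_zero hδ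
  unfold nu5
  fun_prop (disch := first | positivity | exact Or.inl h0.ne')

lemma nu3_one {δ l : ℝ} (hδ : 1 < δ) (hl : 0 < l) (hl1 : l ≤ 1) : nu3 δ 1 l = nuA δ l := by
  have h0 : 0 < δ := by linarith
  have hlog := (log_pos hδ).ne'
  have hsub : δ - 1 ≠ 0 := by linarith
  have hx := (rpow_pos_of_pos h0 l).ne'
  simp only [nu3, nuA, if_pos hl1, mul_add, two_mul, rpow_add h0, rpow_sub h0, rpow_one, rpow_two]
  field_simp
  ring

lemma nu4_one {δ : ℝ} (hδ : 1 < δ) : nu4 δ 1 1 = nuA δ 1 := by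
  have h0 : 0 < δ := by linarith
  have hlog := (log_pos hδ).ne'
  have hsub : δ - 1 ≠ 0 := by linarith
  simp only [nu4, nuA, if_pos le_rfl, mul_add, two_mul, rpow_add h0, rpow_sub h0, rpow_one,
    rpow_two]
  field_simp
  ring

lemma nu5_one {δ l : ℝ} (hδ : 1 < δ) (hl : 1 < l) : nu5 δ 1 l = nuA δ l := by
  have h0 : 0 < δ := by linarith
  have hlog := (log_pos hδ).ne'
  have hsub : δ - 1 ≠ 0 := by linarith
  simp only [nu5, nuA, if_neg hl.not_ge, mul_one, rpow_one, rpow_two]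
  field_simp
  ring

/-- for `δ > 1` and `λ > 0`, `ν(δ,β,λ) → ν_A(δ,λ)` as `β → 1⁻`. -/
theorem nu_tendsto_nuA (δ l : ℝ) (hδ : 1 < δ) (hl : 0 < l) :
    Tendsto (fun β : ℝ => nu δ β l) (nhdsWithin 1 (Set.Iio (1 : ℝ))) (nhds (nuA δ l)) := by
  rcases lt_trichotomy l 1 with h | rfl | h
  · refine tendsto_nu_of_eventually_eq (continuousAt_nu3 hδ hl) (nu3_one hδ hl h.le) ?_ hl
    intro β hβ hβl _ hlβ
    rw [nu, if_neg fun hc => by linarith [hc.trans (min_le_right _ _)],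
      if_neg fun hc => by linarith [hc.1], if_pos ⟨hβ.le, (hlβ h).le⟩]
  · refine tendsto_nu_of_eventually_eq (continuousAt_nu4 hδ hl) (nu4_one hδ) ?_ hl
    intro β hβ hβl hβ1 _
    rw [nu, if_neg fun hc => by linarith [hc.trans (min_le_right _ _)],
      if_neg fun hc => by linarith [hc.1], if_neg fun hc => by linarith [hc.2], if_pos le_rfl]
  · refine tendsto_nu_of_eventually_eq (continuousAt_nu5 hδ hl) (nu5_one hδ h) ?_ hl
    intro β hβ hβl hβ1 _
    rw [nu, if_neg fun hc => by linarith [hc.trans (min_le_right _ _)],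
      if_neg fun hc => by linarith [hc.1], if_neg fun hc => by linarith [hc.2], if_neg h.not_ge]
end

section
/- For every fixed real δ>1, the function β ↦ μ(δ,β) = (δ−1)·δ^(β−1)/(δ^β−1) is strictly decreasing on (0,1]. -/
open Real

/-- Asymptotic multiple-access interference factor of a PRake receiver with
finger fraction `β` under an exponentially decaying aPDP with ratio `δ`. -/
noncomputable def mu (δ β : ℝ) : ℝ := (δ - 1) * δ ^ (β - 1) / (δ ^ β - 1)

/-- for fixed `δ > 1`, `β ↦ μ(δ,β)` is strictly decreasing on `(0,1]`. -/
theorem mu_strictAntiOn_beta (δ : ℝ) (hδ : 1 < δ) :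
    StrictAntiOn (fun β : ℝ => mu δ β) (Set.Ioc (0 : ℝ) 1) := by
  intro x hx y hy hxy
  have hδ0 : 0 < δ := by linarith
  have hpow : ∀ t : ℝ, δ ^ t = δ * δ ^ (t - 1) := fun t => by
    rw [rpow_sub_one hδ0.ne']
    field_simp
  have hlt : δ ^ (x - 1) < δ ^ (y - 1) := rpow_lt_rpow_of_exponent_lt hδ (by linarith)
  have hx1 : 1 < δ ^ x := one_lt_rpow hδ hx.1
  have hy1 : 1 < δ ^ y := one_lt_rpow hδ hy.1
  simp only [mu]
  rw [div_lt_div_iff₀ (by linarith) (by linarith), hpow x, hpow y]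
  nlinarith [mul_pos (sub_pos.2 hδ) (sub_pos.2 hlt)]
end

section
/- For every fixed β∈(0,1), the function δ ↦ μ(δ,β) = (δ−1)·δ^(β−1)/(δ^β−1) is strictly decreasing on (1,∞). -/
open Real

theorem mu_eq_inv {δ : ℝ} (hδ : 0 < δ) (β : ℝ) :
    mu δ β = (1 - δ⁻¹) / (1 - δ⁻¹ ^ β) := by
  have hpow : δ ^ β ≠ 0 := (rpow_pos_of_pos hδ β).ne'
  have hnum : (δ - 1) * δ ^ (β - 1) = (1 - δ⁻¹) * δ ^ β := by
    rw [rpow_sub_one hδ.ne']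
    field_simp
  have hden : δ ^ β - 1 = (1 - δ⁻¹ ^ β) * δ ^ β := by
    rw [inv_rpow hδ.le, sub_mul, inv_mul_cancel₀ hpow, one_mul]
  rw [mu, hnum, hden, mul_div_mul_right _ _ hpow]

/-- for fixed `β ∈ (0,1)`, `δ ↦ μ(δ,β)` is strictly decreasing on `(1,∞)`. -/
theorem mu_strictAntiOn_delta (β : ℝ) (hβ : β ∈ Set.Ioo (0 : ℝ) 1) :
    StrictAntiOn (fun δ : ℝ => mu δ β) (Set.Ioi (1 : ℝ)) := by
  intro a (ha : 1 < a) b (hb : 1 < b) hab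
  have ha₀ : 0 < a := one_pos.trans ha
  have hb₀ : 0 < b := one_pos.trans hb
  have hinv : b⁻¹ < a⁻¹ := inv_strictAnti₀ ha₀ hab
  have ha₁ : a⁻¹ < 1 := inv_lt_one_of_one_lt₀ ha
  have hslope := (strictConcaveOn_rpow hβ.1 hβ.2).slope_anti_adjacent
    (Set.mem_Ici.2 (inv_pos.2 hb₀).le) (Set.mem_Ici.2 zero_le_one) hinv ha₁
  have hpa : a⁻¹ ^ β < 1 := rpow_lt_one (inv_pos.2 ha₀).le ha₁ hβ.1
  have hpb : b⁻¹ ^ β < 1 := rpow_lt_one (inv_pos.2 hb₀).le (hinv.trans ha₁) hβ.1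
  rw [one_rpow, div_lt_div_iff₀ (sub_pos.2 ha₁) (sub_pos.2 hinv)] at hslope
  change mu b β < mu a β
  rw [mu_eq_inv ha₀, mu_eq_inv hb₀, div_lt_div_iff₀ (sub_pos.2 hpb) (sub_pos.2 hpa)]
  linarith
end
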